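/- Let F be a finite field and let V be a countably infinite dimensional F-vector space (e.g. V = ℕ →₀ F). Let H be a subgroup of the group GL(V) of F-linear automorphisms of V. If the index of H in GL(V) is strictly less than 2^ℵ₀, then there exists a finite set A ⊆ V such that the pointwise stabilizer of A is contained in H. -/

import Mathlib

namespace SIP

/-- Small-index consequence: any continuum-sized family has two members in the same coset. -/
def Small {G : Type*} [Group G] (H : Subgroup G) : Prop :=
  ∀ f : Set ℤ → G, ∃ r s, r ≠ s ∧ (f r)⁻¹ * f s ∈ H

theorem small_of_index {G : Type*} [Group G] (H : Subgroup G)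
    (h : Cardinal.mk (G ⧸ H) < 2 ^ Cardinal.aleph0) : Small H := by
  intro f
  by_contra! hc
  have hinj : Function.Injective (fun r => (QuotientGroup.mk (f r) : G ⧸ H)) := by
    intro r s hrs
    by_contra hne
    exact hc r s hne (QuotientGroup.eq.mp hrs)
  have := Cardinal.mk_le_of_injective (hinj.comp ULift.down_injective)
  rw [Cardinal.mk_uLift, Cardinal.mk_set, Cardinal.mk_int] at this
  simp only [Cardinal.lift_power, Cardinal.lift_two, Cardinal.lift_aleph0] at this
  exact absurd h (not_lt.mpr this)

theorem Small.comap {G K : Type*} [Group G] [Group K] {H : Subgroup G} (h : Small H)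
    (φ : K →* G) : Small (H.comap φ) := by
  intro f
  obtain ⟨r, s, hne, hm⟩ := h (fun r => φ (f r))
  exact ⟨r, s, hne, by simpa using hm⟩

theorem exists_full {G K : Type*} [Group G] [Group K] {H : Subgroup G} (h : Small H)
    (D : (ℤ → K) →* G) : ∃ i, ∀ k, ∃ κ : ℤ → K, D κ ∈ H ∧ κ i = k := by
  classical
  by_contra! hc
  choose k hk using hc
  obtain ⟨r, s, hne, hm⟩ := h (fun r => D (fun i => if i ∈ r then k i else 1))
  have hx : ∃ i, ¬ (i ∈ r ↔ i ∈ s) := by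
    by_contra! hh
    exact hne (Set.ext hh)
  obtain ⟨i, hi⟩ := hx
  rw [← map_inv, ← map_mul] at hm
  by_cases h1 : i ∈ r
  · have h2 : i ∉ s := by tauto
    have hm' := H.inv_mem hm
    rw [← map_inv] at hm'
    exact hk i _ hm' (by simp [h1, h2])
  · have h2 : i ∈ s := by tauto
    exact hk i _ hm (by simp [h1, h2])

theorem exists_comm {G : Type*} [Group G] {H : Subgroup G} (h : Small H)
    (D : (ℤ → G) →* G) : ∃ i j, ∀ x y : G,
      D (Pi.mulSingle i (D (Pi.mulSingle j (x * y * x⁻¹ * y⁻¹)))) ∈ H := by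
  classical
  obtain ⟨i, hi⟩ := exists_full h D
  let N : Subgroup G := H.comap (D.comp (MonoidHom.mulSingle (fun _ : ℤ => G) i))
  have hN : Small N := h.comap _
  have hnorm : ∀ n ∈ N, ∀ k, k * n * k⁻¹ ∈ N := by
    intro n hn k
    obtain ⟨κ, hκ, rfl⟩ := hi k
    have hn' : D (Pi.mulSingle i n) ∈ H := hn
    have : D (Pi.mulSingle i (κ i * n * (κ i)⁻¹)) ∈ H := by
      have e : (Pi.mulSingle i (κ i * n * (κ i)⁻¹) : ℤ → G) = κ * Pi.mulSingle i n * κ⁻¹ := by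
        funext m
        by_cases hm : m = i
        · subst hm; simp
        · simp [hm]
      rw [e, map_mul, map_mul, map_inv]
      exact H.mul_mem (H.mul_mem hκ hn') (H.inv_mem hκ)
    exact this
  obtain ⟨j, hj⟩ := exists_full hN D
  refine ⟨i, j, fun x y => ?_⟩
  obtain ⟨κ, hκ, rfl⟩ := hj x
  have : D (Pi.mulSingle j (κ j * y * (κ j)⁻¹ * y⁻¹)) ∈ N := by
    have e : (Pi.mulSingle j (κ j * y * (κ j)⁻¹ * y⁻¹) : ℤ → G)
        = κ * (Pi.mulSingle j y * κ⁻¹ * (Pi.mulSingle j y)⁻¹) := by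
      funext m
      by_cases hm : m = j
      · subst hm; simp [mul_assoc]
      · simp [hm]
    rw [e, map_mul, map_mul, map_mul, map_inv, map_inv]
    exact N.mul_mem hκ (hnorm _ (N.inv_mem hκ) _)
  exact this

variable {F : Type*} [Field F] {V : Type*} [AddCommGroup V] [Module F V]

/-- A decomposition of `V` into `ℤ`-many copies of itself. -/
structure Sys (F : Type*) [Field F] (V : Type*) [AddCommGroup V] [Module F V] where
  u : ℤ → V →ₗ[F] V
  p : ℤ → V →ₗ[F] V
  pu : ∀ n v, p n (u n v) = v
  pu' : ∀ m n v, m ≠ n → p m (u n v) = 0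
  ext : ∀ v w, (∀ n, p n v = p n w) → v = w
  D : (ℤ → (V ≃ₗ[F] V)) → (V ≃ₗ[F] V)
  pD : ∀ κ n v, p n (D κ v) = κ n (p n v)
  s : V ≃ₗ[F] V
  ps : ∀ n v, p n (s v) = p (n + 1) v
  L : Set ℤ → V →ₗ[F] V
  Lu : ∀ r n v, n ∈ r → L r (u n v) = v
  Lu' : ∀ r n v, n ∉ r → L r (u n v) = 0

theorem exists_sys (hdim : Module.rank F V = Cardinal.aleph0) : Nonempty (Sys F V) := by
  classical
  have hr : Module.rank F V = Module.rank F (Π₀ _ : ℤ, V) := by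
    have h1 : Module.rank F (Π₀ _ : ℤ, V) = Module.rank F (ℤ →₀ V) :=
      (LinearEquiv.rank_eq (finsuppLequivDFinsupp F)).symm
    rw [h1, rank_finsupp, hdim]
    simp
  obtain ⟨e⟩ := nonempty_linearEquiv_of_rank_eq hr
  refine ⟨{
    u := fun n => e.symm.toLinearMap ∘ₗ DFinsupp.lsingle (R := F) (M := fun _ : ℤ => V) n
    p := fun n => DFinsupp.lapply (R := F) (M := fun _ : ℤ => V) n ∘ₗ e.toLinearMap
    pu := by intro n v; simp
    pu' := by intro m n v h; simp [DFinsupp.single_apply, h.symm]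
    ext := ?_
    D := fun κ => e ≪≫ₗ DFinsupp.mapRange.linearEquiv κ ≪≫ₗ e.symm
    pD := by intro κ n v; simp
    s := e ≪≫ₗ (DirectSum.lequivCongrLeft F (M := fun _ : ℤ => V) (Equiv.addRight (-1 : ℤ)))
       ≪≫ₗ e.symm
    ps := ?_
    L := fun r => (DFinsupp.lsum ℕ (fun n => if n ∈ r then LinearMap.id else 0)) ∘ₗ e.toLinearMap
    Lu := by intro r n v h; simp [h]
    Lu' := by intro r n v h; simp [h] }⟩
  · intro v w h
    apply e.injective
    ext n
    exact h n
  · intro n v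
    simp
    erw [DirectSum.lequivCongrLeft_apply]

namespace Sys

variable (S : Sys F V)

/-- The block-diagonal embedding as a group homomorphism. -/
def hom : (ℤ → (V ≃ₗ[F] V)) →* (V ≃ₗ[F] V) where
  toFun := S.D
  map_one' := by
    ext v
    apply S.ext
    intro n
    simp [S.pD]
  map_mul' := by
    intro a b
    ext v
    apply S.ext
    intro n
    simp [S.pD]

theorem hom_single (n : ℤ) (x : V ≃ₗ[F] V) (v : V) :
    S.hom (Pi.mulSingle n x) v = v + S.u n (x (S.p n v) - S.p n v) := by
  classical
  apply S.ext
  intro m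
  change S.p m (S.D _ v) = _
  rw [S.pD]
  by_cases h : m = n
  · subst h
    simp [S.pu]
  · rw [map_add, S.pu' _ _ _ h]
    simp [h]

theorem hom_comm (x : V ≃ₗ[F] V) : ∃ y z : V ≃ₗ[F] V,
    S.hom (Pi.mulSingle 0 x) = y * z * y⁻¹ * z⁻¹ := by
  classical
  let κ : ℤ → (V ≃ₗ[F] V) := fun n => if 0 ≤ n then x else 1
  refine ⟨S.hom κ, S.s⁻¹, ?_⟩
  have key : S.hom (Pi.mulSingle 0 x) * (S.s⁻¹ * S.hom κ * S.s) = S.hom κ := by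
    have hs : ∀ n v, S.p n (S.s⁻¹ v) = S.p (n - 1) v := by
      intro n v
      have := S.ps (n - 1) (S.s⁻¹ v)
      rw [sub_add_cancel] at this
      rw [← this]
      congr 1
      exact (S.s.apply_symm_apply v)
    ext v
    apply S.ext
    intro n
    change S.p n (S.D _ (S.s⁻¹ (S.D κ (S.s v)))) = S.p n (S.D κ v)
    rw [S.pD, hs, S.pD, S.ps, S.pD, sub_add_cancel]
    rcases lt_trichotomy n 0 with h | h | h
    · have h1 : ¬ (0 ≤ n - 1) := by omega
      have h2 : ¬ (0 ≤ n) := by omega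
      simp only [κ, h1, h2, if_false]
      simp [h.ne]
    · subst h
      simp [κ]
    · have h1 : (0 ≤ n - 1) := by omega
      have h2 : (0 ≤ n) := by omega
      simp only [κ, h1, h2, if_true]
      simp [h.ne']
  rw [eq_mul_inv_of_mul_eq key]
  group

end Sys

/-- Step A. -/
theorem stepA (S : Sys F V) {H : Subgroup (V ≃ₗ[F] V)} (hH : Small H) :
    ∃ U P W : V →ₗ[F] V, (∀ v, P (U v) = v) ∧ (∀ v, P (W v) = 0) ∧ Function.Injective W ∧
      ∀ x : V ≃ₗ[F] V, ∃ h ∈ H, ∀ v, h v = v + U (x (P v) - P v) := by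
  obtain ⟨i, j, hij⟩ := exists_comm hH S.hom
  refine ⟨S.u i ∘ₗ S.u j ∘ₗ S.u 0, S.p 0 ∘ₗ S.p j ∘ₗ S.p i, S.u (i + 1), ?_, ?_, ?_, ?_⟩
  · intro v; simp [S.pu]
  · intro v; simp [S.pu' i (i + 1) v (by omega)]
  · intro a b hab
    rw [← S.pu (i + 1) a, hab, S.pu]
  · intro x
    obtain ⟨y, z, hyz⟩ := S.hom_comm x
    refine ⟨_, hij y z, fun v => ?_⟩
    rw [← hyz]
    simp [S.hom_single]

/-- unipotent elements -/
def tv (t P : V →ₗ[F] V) (h : ∀ v, P (t v) = 0) : V ≃ₗ[F] V :=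
  LinearEquiv.ofLinearMap (LinearMap.id + t ∘ₗ P) (LinearMap.id - t ∘ₗ P)
    (by ext v; simp [h]) (by ext v; simp [h])

theorem tv_apply (t P : V →ₗ[F] V) (h : ∀ v, P (t v) = 0) (v : V) :
    tv t P h v = v + t (P v) := rfl

/-- split surjections with infinite-dimensional kernel -/
def Good (s : V →ₗ[F] V) : Prop :=
  ∃ u w : V →ₗ[F] V, (∀ v, s (u v) = v) ∧ (∀ v, s (w v) = 0) ∧ Function.Injective w

theorem not_finite (hdim : Module.rank F V = Cardinal.aleph0) : ¬ Module.Finite F V := by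
  rw [← Module.rank_lt_aleph0_iff, hdim]
  exact lt_irrefl _

theorem sub_iso (hdim : Module.rank F V = Cardinal.aleph0) (S : Submodule F V)
    (h : ¬ Module.Finite F S) : Nonempty (S ≃ₗ[F] V) := by
  apply nonempty_linearEquiv_of_rank_eq
  rw [← Module.rank_lt_aleph0_iff, not_lt] at h
  rw [hdim]
  exact le_antisymm (hdim ▸ Submodule.rank_le S) h

theorem sub_iso' (hdim : Module.rank F V = Cardinal.aleph0) (S : Submodule F V)
    (w : V →ₗ[F] V) (hw : Function.Injective w) (hS : ∀ v, w v ∈ S) :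
    Nonempty (S ≃ₗ[F] V) := by
  apply sub_iso hdim
  intro hf
  apply not_finite hdim
  refine Module.Finite.of_injective (w.codRestrict S hS) ?_
  intro a b hab
  exact hw (congrArg Subtype.val hab)

theorem good_split {s : V →ₗ[F] V} (u : V →ₗ[F] V) (hu : ∀ v, s (u v) = v) :
    ∃ φ : V ≃ₗ[F] (V × LinearMap.ker s), ∀ v, (φ v).1 = s v := by
  let f : V →ₗ[F] V × LinearMap.ker s := LinearMap.prod s
    ((LinearMap.id - u ∘ₗ s).codRestrict (LinearMap.ker s) (by intro v; simp [hu]))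
  let g : V × LinearMap.ker s →ₗ[F] V := LinearMap.coprod u (LinearMap.ker s).subtype
  refine ⟨LinearEquiv.ofLinearMap f g ?_ ?_, fun v => rfl⟩
  · apply LinearMap.ext
    rintro ⟨a, b, hb⟩
    have hb' : s b = 0 := hb
    ext <;> simp [f, g, hu, hb']
  · ext v
    simp [f, g]

theorem good_trans (hdim : Module.rank F V = Cardinal.aleph0) {s t : V →ₗ[F] V}
    (hs : Good s) (ht : Good t) : ∃ x : V ≃ₗ[F] V, ∀ v, s v = t (x v) := by
  obtain ⟨u, w, hu, hw, hi⟩ := hs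
  obtain ⟨u', w', hu', hw', hi'⟩ := ht
  obtain ⟨φ, hφ⟩ := good_split u hu
  obtain ⟨ψ, hψ⟩ := good_split u' hu'
  obtain ⟨k⟩ := sub_iso' hdim (LinearMap.ker s) w hi hw
  obtain ⟨k'⟩ := sub_iso' hdim (LinearMap.ker t) w' hi' hw'
  refine ⟨φ ≪≫ₗ LinearEquiv.prodCongr (LinearEquiv.refl F V) (k ≪≫ₗ k'.symm) ≪≫ₗ ψ.symm, ?_⟩
  intro v
  rw [← hψ]
  simp [hφ]

/-- Second step: the full pointwise stabilizer of `ker P`. -/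
theorem stepA' (hdim : Module.rank F V = Cardinal.aleph0) (S : Sys F V)
    {H : Subgroup (V ≃ₗ[F] V)} (hH : Small H) (U P : V →ₗ[F] V) (hPU : ∀ v, P (U v) = v)
    (hx : ∀ x : V ≃ₗ[F] V, ∃ h ∈ H, ∀ v, h v = v + U (x (P v) - P v))
    (g : V ≃ₗ[F] V) (hg : ∀ v, P v = 0 → g v = v) : g ∈ H := by
  -- unipotent part
  have huni : ∀ (a : V →ₗ[F] V) (ha : ∀ v, P (a v) = 0), tv a P ha ∈ H := by
    intro a ha
    have ha' : ∀ (s : V →ₗ[F] V) (v : V), P ((a ∘ₗ s) v) = 0 := fun s v => ha _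
    have hpre : ∀ (s : V →ₗ[F] V) (x : V ≃ₗ[F] V) (t : V →ₗ[F] V), (∀ v, t v = s (x v)) →
        tv (a ∘ₗ s) P (ha' _) ∈ H → tv (a ∘ₗ t) P (ha' _) ∈ H := by
      intro s x t ht hs
      obtain ⟨h, hh, hv⟩ := hx x
      have : tv (a ∘ₗ t) P (ha' _) = h⁻¹ * tv (a ∘ₗ s) P (ha' _) * h := by
        rw [mul_assoc, eq_inv_mul_iff_mul_eq]
        ext v
        have h2 : P (h v) = x (P v) := by rw [hv]; simp [hPU]
        have h3 : P (v + a (t (P v))) = P v := by simp [ha]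
        rw [LinearEquiv.mul_apply, LinearEquiv.mul_apply, tv_apply, tv_apply, h2, hv]
        rw [hv, LinearMap.comp_apply, LinearMap.comp_apply, h3, ht]
        abel
      rw [this]
      exact H.mul_mem (H.mul_mem (H.inv_mem hh) hs) hh
    obtain ⟨r, s, hne, hrs⟩ := hH (fun r => tv (a ∘ₗ (S.L r ∘ₗ S.p 0)) P (ha' _))
    let s0 : V →ₗ[F] V := (S.L s - S.L r) ∘ₗ S.p 0
    have hs0 : tv (a ∘ₗ s0) P (ha' _) ∈ H := by
      convert hrs using 1
      rw [eq_inv_mul_iff_mul_eq]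
      ext v
      simp [tv_apply, s0, ha]
      abel
    have g0 : Good s0 := by
      have hx : ∃ i, ¬ (i ∈ r ↔ i ∈ s) := by
        by_contra! hh
        exact hne (Set.ext hh)
      obtain ⟨i, hi⟩ := hx
      have hk : ∀ v, s0 (S.u 1 v) = 0 := by
        intro v; simp [s0, S.pu' 0 1 v (by omega)]
      have hinj : Function.Injective (S.u 1) := by
        intro a b hab
        rw [← S.pu 1 a, hab, S.pu]
      by_cases h1 : i ∈ r
      · have h2 : i ∉ s := by tauto
        refine ⟨-(S.u 0 ∘ₗ S.u i), S.u 1, fun v => ?_, hk, hinj⟩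
        simp [s0, S.pu, S.Lu r i v h1, S.Lu' s i v h2]
      · have h2 : i ∈ s := by tauto
        refine ⟨(S.u 0 ∘ₗ S.u i), S.u 1, fun v => ?_, hk, hinj⟩
        simp [s0, S.pu, S.Lu s i v h2, S.Lu' r i v h1]
    have hgood : ∀ t : V →ₗ[F] V, Good t → tv (a ∘ₗ t) P (ha' _) ∈ H := by
      intro t ht
      obtain ⟨x, hx⟩ := good_trans hdim ht g0
      exact hpre s0 x t hx hs0
    let s1 : V →ₗ[F] V := S.p 1 + (S.u 2 ∘ₗ S.p 2 - S.p 2) + S.u 3 ∘ₗ S.p 3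
    let s2 : V →ₗ[F] V := LinearMap.id - s1
    have hinj : ∀ n, Function.Injective (S.u n) := by
      intro n a b hab
      rw [← S.pu n a, hab, S.pu]
    have g1 : Good s1 := by
      refine ⟨S.u 1, S.u 4, fun v => ?_, fun v => ?_, hinj _⟩
      · simp [s1, S.pu, S.pu' 2 1 v (by omega), S.pu' 3 1 v (by omega)]
      · simp [s1, S.pu' 1 4 v (by omega), S.pu' 2 4 v (by omega), S.pu' 3 4 v (by omega)]
    have g2 : Good s2 := by
      refine ⟨S.u 2, S.u 3, fun v => ?_, fun v => ?_, hinj _⟩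
      · simp [s2, s1, S.pu, S.pu' 1 2 v (by omega), S.pu' 3 2 v (by omega)]
      · simp [s2, s1, S.pu, S.pu' 1 3 v (by omega), S.pu' 2 3 v (by omega)]
    have : tv a P ha = tv (a ∘ₗ s1) P (ha' _) * tv (a ∘ₗ s2) P (ha' _) := by
      ext v
      simp only [LinearEquiv.mul_apply, tv_apply, map_add, LinearMap.comp_apply, ha, s2,
        LinearMap.sub_apply, LinearMap.id_apply, map_sub, map_zero, add_zero]
      abel_nf
    rw [this]
    exact H.mul_mem (hgood _ g1) (hgood _ g2)
  have hgi : ∀ v, P v = 0 → g.symm v = v := by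
    intro v hv
    rw [LinearEquiv.symm_apply_eq, hg v hv]
  have hdec : ∀ v, P (v - U (P v)) = 0 := by intro v; simp [hPU]
  have e1 : ∀ v, P (g (U (P (g.symm v)))) = P v := by
    intro v
    have h1 := hg _ (hdec (g.symm v))
    have h2 := hdec (g.symm v)
    rw [← h1] at h2
    simp only [map_sub, LinearEquiv.apply_symm_apply] at h2
    exact (sub_eq_zero.mp h2).symm
  have e2 : ∀ v, P (g.symm (U (P (g v)))) = P v := by
    intro v
    have h1 := hgi _ (hdec (g v))
    have h2 := hdec (g v)
    rw [← h1] at h2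
    simp only [map_sub, LinearEquiv.symm_apply_apply] at h2
    exact (sub_eq_zero.mp h2).symm
  let x : V ≃ₗ[F] V := LinearEquiv.ofLinearMap (P ∘ₗ g.toLinearMap ∘ₗ U)
    (P ∘ₗ g.symm.toLinearMap ∘ₗ U) (by ext v; simp [e1, hPU]) (by ext v; simp [e2, hPU])
  have hxv : ∀ v, x v = P (g (U v)) := fun v => rfl
  obtain ⟨h, hh, hv⟩ := hx x
  let a : V →ₗ[F] V := g.toLinearMap ∘ₗ U ∘ₗ x.symm.toLinearMap - U
  have ha : ∀ v, P (a v) = 0 := by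
    intro v
    simp [a, hPU, ← hxv]
  have : g = tv a P ha * h := by
    ext v
    have h1 := hg _ (hdec v)
    rw [map_sub, sub_eq_iff_eq_add] at h1
    have h2 : P (h v) = x (P v) := by rw [hv]; simp [hPU]
    rw [LinearEquiv.mul_apply, tv_apply, h2, hv, h1]
    simp [a]
    abel
  rw [this]
  exact H.mul_mem (huni a ha) hh

theorem triple (A D E : Submodule F V) (hAD : Disjoint A D) (hE : IsCompl (A ⊔ D) E) :
    ∃ φ : (A × D × E) ≃ₗ[F] V, ∀ a d e, φ (a, d, e) = (a : V) + ((d : V) + (e : V)) := by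
  let f : (A × D × E) →ₗ[F] V := LinearMap.coprod A.subtype (LinearMap.coprod D.subtype E.subtype)
  have hf : ∀ a d e, f (a, d, e) = (a : V) + ((d : V) + (e : V)) := fun a d e => rfl
  refine ⟨LinearEquiv.ofBijective f ⟨?_, ?_⟩, hf⟩
  · rw [injective_iff_map_eq_zero]
    rintro ⟨⟨a, ha⟩, ⟨d, hd⟩, ⟨e, he⟩⟩ h
    rw [hf] at h
    simp only at h
    have h1 : a + d ∈ A ⊔ D := Submodule.add_mem_sup ha hd
    have h2 : e = -(a + d) := by
      rw [← add_assoc] at h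
      exact eq_neg_of_add_eq_zero_right h
    have h3 : e = 0 := by
      refine Submodule.disjoint_def.mp hE.disjoint e ?_ he
      rw [h2]; exact Submodule.neg_mem _ h1
    subst h3
    rw [add_zero] at h
    have h4 : a = 0 := by
      refine Submodule.disjoint_def.mp hAD a ha ?_
      rw [eq_neg_of_add_eq_zero_left h]
      exact Submodule.neg_mem _ hd
    subst h4
    have h5 : d = 0 := by simpa using h
    subst h5
    rfl
  · intro v
    have hv : v ∈ (A ⊔ D) ⊔ E := by rw [hE.sup_eq_top]; trivial
    obtain ⟨y, hy, e, he, rfl⟩ := Submodule.mem_sup.mp hv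
    obtain ⟨a, ha, d, hd, rfl⟩ := Submodule.mem_sup.mp hy
    exact ⟨(⟨a, ha⟩, ⟨d, hd⟩, ⟨e, he⟩), by rw [hf]; simp [add_assoc]⟩

/-- infinite codimension -/
def InfCo (S : Submodule F V) : Prop := ∃ w : V →ₗ[F] V, ∀ v, w v ∈ S → v = 0

theorem InfCo.mono {S T : Submodule F V} (h : InfCo T) (hST : S ≤ T) : InfCo S := by
  obtain ⟨w, hw⟩ := h
  exact ⟨w, fun v hv => hw v (hST hv)⟩

theorem InfCo.compl_iso (hdim : Module.rank F V = Cardinal.aleph0) {S E : Submodule F V}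
    (h : InfCo S) (hE : IsCompl S E) : Nonempty (E ≃ₗ[F] V) := by
  obtain ⟨w, hw⟩ := h
  apply sub_iso hdim
  intro hf
  apply not_finite hdim
  have : Module.Finite F (V ⧸ S) :=
    Module.Finite.equiv (Submodule.quotientEquivOfIsCompl S E hE).symm
  refine Module.Finite.of_injective (S.mkQ ∘ₗ w) ?_
  rw [injective_iff_map_eq_zero]
  intro v hv
  apply hw
  simpa using hv

theorem extend (hdim : Module.rank F V = Cardinal.aleph0) {A D A' D' : Submodule F V}
    (h : Disjoint A D) (h' : Disjoint A' D') (hc : InfCo (A ⊔ D)) (hc' : InfCo (A' ⊔ D'))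
    (α : A ≃ₗ[F] A') (δ : D ≃ₗ[F] D') :
    ∃ x : V ≃ₗ[F] V, (∀ a : A, x a = α a) ∧ (∀ d : D, x d = δ d) := by
  obtain ⟨E, hE⟩ := Submodule.exists_isCompl (A ⊔ D)
  obtain ⟨E', hE'⟩ := Submodule.exists_isCompl (A' ⊔ D')
  obtain ⟨k⟩ := hc.compl_iso hdim hE
  obtain ⟨k'⟩ := hc'.compl_iso hdim hE'
  obtain ⟨φ, hφ⟩ := triple A D E h hE
  obtain ⟨ψ, hψ⟩ := triple A' D' E' h' hE'
  refine ⟨φ.symm ≪≫ₗ LinearEquiv.prodCongr α (LinearEquiv.prodCongr δ (k ≪≫ₗ k'.symm)) ≪≫ₗ ψ,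
    fun a => ?_, fun d => ?_⟩
  · have : (a : V) = φ (a, 0, 0) := by rw [hφ]; simp
    rw [this]
    simp [hψ]
  · have : (d : V) = φ (0, d, 0) := by rw [hφ]; simp
    rw [this]
    simp [hψ]

theorem avoid {A B : Submodule F V} (hA : A ≠ ⊤) (hB : B ≠ ⊤) : ∃ v, v ∉ A ∧ v ∉ B := by
  have hx : ∃ x, x ∉ A := by
    by_contra! h; exact hA (Submodule.eq_top_iff'.mpr h)
  have hy : ∃ x, x ∉ B := by
    by_contra! h; exact hB (Submodule.eq_top_iff'.mpr h)
  obtain ⟨x, hx⟩ := hx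
  obtain ⟨y, hy⟩ := hy
  by_cases h1 : x ∈ B
  · by_cases h2 : y ∈ A
    · refine ⟨x + y, fun h => hx ?_, fun h => hy ?_⟩
      · exact (Submodule.add_mem_iff_left A h2).mp h
      · exact (Submodule.add_mem_iff_right B h1).mp h
    · exact ⟨y, h2, hy⟩
  · exact ⟨x, hx, h1⟩

theorem disj_extend {A D : Submodule F V} (h : Disjoint D A) {v : V} (hv : v ∉ A ⊔ D) :
    Disjoint (D ⊔ Submodule.span F {v}) A := by
  rw [Submodule.disjoint_def]
  intro x hx hxA
  obtain ⟨d, hd, y, hy, rfl⟩ := Submodule.mem_sup.mp hx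
  obtain ⟨c, rfl⟩ := Submodule.mem_span_singleton.mp hy
  by_cases hc : c = 0
  · subst hc
    simp only [zero_smul, add_zero] at hxA ⊢
    exact Submodule.disjoint_def.mp h d hd hxA
  · exfalso
    apply hv
    have : c • v ∈ A ⊔ D := by
      have e : c • v = (d + c • v) + (-d) := by abel
      rw [e]
      exact Submodule.add_mem_sup hxA (Submodule.neg_mem _ hd)
    exact (Submodule.smul_mem_iff _ hc).mp this

theorem InfCo.sup_finite (hdim : Module.rank F V = Cardinal.aleph0) {A D : Submodule F V}
    (h : InfCo A) (hD : Module.Finite F D) : A ⊔ D ≠ ⊤ := by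
  intro htop
  obtain ⟨w, hw⟩ := h
  apply not_finite hdim
  have hs : Function.Surjective (A.mkQ ∘ₗ D.subtype) := by
    intro y
    obtain ⟨v, rfl⟩ := A.mkQ_surjective y
    have hv : v ∈ A ⊔ D := by rw [htop]; trivial
    obtain ⟨a, ha, d, hd, rfl⟩ := Submodule.mem_sup.mp hv
    refine ⟨⟨d, hd⟩, ?_⟩
    have : A.mkQ a = 0 := by simpa using ha
    rw [map_add, this, zero_add]
    rfl
  have : Module.Finite F (V ⧸ A) := Module.Finite.of_surjective _ hs
  refine Module.Finite.of_injective (A.mkQ ∘ₗ w) ?_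
  rw [injective_iff_map_eq_zero]
  intro v hv
  apply hw
  simpa using hv

theorem exists_D (hdim : Module.rank F V = Cardinal.aleph0) {A B : Submodule F V}
    (hA : InfCo A) (hB : InfCo B) :
    ∃ d : V →ₗ[F] V, Function.Injective d ∧ (∀ v, d v ∈ A → v = 0) ∧ (∀ v, d v ∈ B → v = 0) := by
  obtain ⟨D, hD⟩ := zorn_le₀ {D : Submodule F V | Disjoint D A ∧ Disjoint D B} (by
    intro c hc hch
    refine ⟨sSup c, ⟨?_, ?_⟩, fun z hz => le_sSup hz⟩
    · rw [DirectedOn.disjoint_sSup_left hch.directedOn]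
      exact fun z hz => (hc hz).1
    · rw [DirectedOn.disjoint_sSup_left hch.directedOn]
      exact fun z hz => (hc hz).2)
  have hDA : Disjoint D A := hD.prop.1
  have hDB : Disjoint D B := hD.prop.2
  have hinf : ¬ Module.Finite F D := by
    intro hfin
    obtain ⟨v, h1, h2⟩ := avoid (hA.sup_finite hdim hfin) (hB.sup_finite hdim hfin)
    have hle := hD.le_of_ge (y := D ⊔ Submodule.span F {v})
      ⟨disj_extend hDA h1, disj_extend hDB h2⟩ le_sup_left
    apply h1
    apply Submodule.mem_sup_right
    apply hle
    apply Submodule.mem_sup_right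
    exact Submodule.mem_span_singleton_self v
  obtain ⟨k⟩ := sub_iso hdim D hinf
  refine ⟨D.subtype ∘ₗ k.symm.toLinearMap, ?_, ?_, ?_⟩
  · exact D.injective_subtype.comp k.symm.injective
  · intro v hv
    have := Submodule.disjoint_def.mp hDA _ (k.symm v).2 hv
    simpa using this
  · intro v hv
    have := Submodule.disjoint_def.mp hDB _ (k.symm v).2 hv
    simpa using this

theorem gen (hdim : Module.rank F V = Cardinal.aleph0) (S : Sys F V)
    {H : Subgroup (V ≃ₗ[F] V)} {A B₀ C : Submodule F V} (hCA : C ≤ A) (hAB : Disjoint A B₀)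
    (hB : Nonempty (B₀ ≃ₗ[F] V)) (hco : InfCo (A ⊔ B₀))
    (h1 : ∀ g : V ≃ₗ[F] V, (∀ a ∈ A, g a = a) → g ∈ H)
    (h2 : ∀ g : V ≃ₗ[F] V, (∀ a ∈ C ⊔ B₀, g a = a) → g ∈ H)
    (g : V ≃ₗ[F] V) (hg : ∀ a ∈ C, g a = a) : g ∈ H := by
  have hA : InfCo A := hco.mono le_sup_left
  let A' : Submodule F V := A.map g.toLinearMap
  have hA' : InfCo A' := by
    obtain ⟨w, hw⟩ := hA
    refine ⟨g.toLinearMap ∘ₗ w, fun v hv => hw v ?_⟩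
    obtain ⟨a, ha, hav⟩ := hv
    have : a = w v := g.injective hav
    rwa [← this]
  obtain ⟨d, hdi, hdA, hdA'⟩ := exists_D hdim hA hA'
  have hinj : ∀ n, Function.Injective (S.u n) := by
    intro n a b hab
    rw [← S.pu n a, hab, S.pu]
  let D : Submodule F V := LinearMap.range (d ∘ₗ S.u 0)
  have hdis : ∀ X : Submodule F V, (∀ v, d v ∈ X → v = 0) → Disjoint X D := by
    intro X hX
    rw [Submodule.disjoint_def]
    rintro x hx ⟨v, rfl⟩
    have := hX _ hx
    rw [LinearMap.comp_apply, this, map_zero]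
  have hcoX : ∀ X : Submodule F V, (∀ v, d v ∈ X → v = 0) → InfCo (X ⊔ D) := by
    intro X hX
    refine ⟨d ∘ₗ S.u 1, fun v hv => ?_⟩
    obtain ⟨x, hx, y, ⟨z, rfl⟩, hxy⟩ := Submodule.mem_sup.mp hv
    have hx' : x = d (S.u 1 v - S.u 0 z) := by
      rw [map_sub, eq_sub_iff_add_eq]
      exact hxy
    rw [hx'] at hx
    have h0 := hX _ hx
    have := congrArg (S.p 1) h0
    rw [map_sub, S.pu, S.pu' 1 0 z (by omega)] at this
    simpa using this
  obtain ⟨kB⟩ := hB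
  let kD : V ≃ₗ[F] D := LinearEquiv.ofInjective (d ∘ₗ S.u 0) (hdi.comp (hinj 0))
  obtain ⟨h, hhA, hhB⟩ := extend hdim hAB (hdis A hdA) hco (hcoX A hdA) (LinearEquiv.refl F A)
    (kB ≪≫ₗ kD)
  obtain ⟨k, hkA, hkD⟩ := extend hdim (hdis A hdA) (hdis A' hdA') (hcoX A hdA) (hcoX A' hdA')
    (g.submoduleMap A) (LinearEquiv.refl F D)
  have hhH : h ∈ H := h1 h (fun a ha => hhA ⟨a, ha⟩)
  have hkg : ∀ a ∈ A, k a = g a := fun a ha => hkA ⟨a, ha⟩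
  have hkD' : ∀ a ∈ D, k a = a := fun a ha => hkD ⟨a, ha⟩
  have hconj : h⁻¹ * k * h ∈ H := by
    apply h2
    intro b hb
    obtain ⟨c, hc, b₀, hb₀, rfl⟩ := Submodule.mem_sup.mp hb
    have e1 : h c = c := hhA ⟨c, hCA hc⟩
    have e2 : h b₀ ∈ D := by
      have := hhB ⟨b₀, hb₀⟩
      simp only at this
      rw [this]
      exact Subtype.property _
    have e3 : k (h (c + b₀)) = h (c + b₀) := by
      rw [map_add, map_add, e1, hkD' _ e2, hkg c (hCA hc), hg c hc]
    change h.symm (k (h (c + b₀))) = _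
    rw [e3, LinearEquiv.symm_apply_apply]
  have hk : k ∈ H := by
    have := H.mul_mem (H.mul_mem hhH hconj) (H.inv_mem hhH)
    convert this using 1
    group
  have hkg' : k⁻¹ * g ∈ H := by
    apply h1
    intro a ha
    change k.symm (g a) = a
    rw [← hkg a ha, LinearEquiv.symm_apply_apply]
  have := H.mul_mem hk hkg'
  simpa using this

/-- node of the branch `r` at level `n` -/
noncomputable def node (r : Set ℤ) (n : ℕ) : ℕ × Finset ℤ :=
  open Classical in (n, (Finset.Icc (-(n : ℤ)) n).filter (· ∈ r))

theorem node_inj (r : Set ℤ) : Function.Injective (node r) := by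
  intro m n h
  exact congrArg Prod.fst h

theorem node_inter {r s : Set ℤ} (h : r ≠ s) : (Set.range (node r) ∩ Set.range (node s)).Finite := by
  have hx : ∃ i, ¬ (i ∈ r ↔ i ∈ s) := by
    by_contra! hh
    exact h (Set.ext hh)
  obtain ⟨i, hi⟩ := hx
  refine ((Set.finite_Iio i.natAbs).image (node r)).subset ?_
  rintro _ ⟨⟨n, rfl⟩, ⟨m, hm⟩⟩
  have hmn : m = n := congrArg Prod.fst hm
  subst hmn
  refine ⟨m, ?_, rfl⟩
  by_contra hlt
  apply hi
  have h2 := congrArg Prod.snd hm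
  have h3 := Finset.ext_iff.mp h2 i
  simp only [node, Finset.mem_filter, Finset.mem_Icc] at h3
  have h4 : -(m : ℤ) ≤ i ∧ i ≤ m := by
    simp only [Set.mem_Iio, not_lt] at hlt
    omega
  tauto

theorem node_compl (r s : Set ℤ) : ((Set.range (node r) ∪ Set.range (node s))ᶜ).Infinite := by
  have hinj : Function.Injective (fun k : ℕ => ((0 : ℕ), ({(k : ℤ) + 1} : Finset ℤ))) := by
    intro a b h
    simpa using h
  refine (Set.infinite_range_of_injective hinj).mono ?_
  have key : ∀ (t : Set ℤ) (k m : ℕ), node t m ≠ ((0 : ℕ), ({(k : ℤ) + 1} : Finset ℤ)) := by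
    intro t k m h
    have hm : m = 0 := congrArg Prod.fst h
    subst hm
    have h3 := Finset.ext_iff.mp (congrArg Prod.snd h) ((k : ℤ) + 1)
    simp only [node, Finset.mem_filter, Finset.mem_Icc, Finset.mem_singleton] at h3
    have := h3.mpr trivial
    omega
  rintro _ ⟨k, rfl⟩ (⟨m, hm⟩ | ⟨m, hm⟩)
  · exact key r k m hm
  · exact key s k m hm

theorem span_iso (hdim : Module.rank F V = Cardinal.aleph0) {J : Type*} (b : Module.Basis J F V)
    {X : Set J} (hX : X.Infinite) : Nonempty (Submodule.span F (b '' X) ≃ₗ[F] V) := by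
  apply sub_iso hdim
  intro hf
  have hli : LinearIndependent F (fun x : X => (⟨b x, Submodule.subset_span ⟨x, x.2, rfl⟩⟩ :
      Submodule.span F (b '' X))) := by
    apply LinearIndependent.of_comp (Submodule.span F (b '' X)).subtype
    exact b.linearIndependent.comp _ Subtype.val_injective
  have := hli.finite
  exact hX (Set.toFinite X)

theorem span_infCo (hdim : Module.rank F V = Cardinal.aleph0) {J : Type*} (b : Module.Basis J F V)
    {X : Set J} (hX : Xᶜ.Infinite) : InfCo (Submodule.span F (b '' X)) := by
  obtain ⟨k⟩ := span_iso hdim b hX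
  refine ⟨(Submodule.span F (b '' Xᶜ)).subtype ∘ₗ k.symm.toLinearMap, fun v hv => ?_⟩
  have hd := b.linearIndependent.disjoint_span_image (disjoint_compl_right (a := X))
  have := Submodule.disjoint_def.mp hd _ hv (k.symm v).2
  simpa using this

theorem main (hdim : Module.rank F V = Cardinal.aleph0) (H : Subgroup (V ≃ₗ[F] V))
    (hH : Small H) :
    ∃ A : Set V, A.Finite ∧ ∀ g : V ≃ₗ[F] V, (∀ a ∈ A, g a = a) → g ∈ H := by
  obtain ⟨S⟩ := exists_sys hdim
  obtain ⟨U, P, W, hPU, hPW, hW, hx⟩ := stepA S hH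
  have hst := stepA' hdim S hH U P hPU hx
  obtain ⟨e⟩ : Nonempty (V ≃ₗ[F] ((ℕ × Finset ℤ) →₀ F)) := by
    apply nonempty_linearEquiv_of_lift_rank_eq
    rw [hdim, rank_finsupp_self]
    simp
  let b : Module.Basis (ℕ × Finset ℤ) F V := Module.Basis.ofRepr e
  obtain ⟨kW⟩ := sub_iso' hdim (LinearMap.ker P) W hW hPW
  have hcoW : InfCo (LinearMap.ker P) := ⟨U, fun v hv => by
    have : P (U v) = 0 := hv
    rwa [hPU] at this⟩
  let N : Set ℤ → Set (ℕ × Finset ℤ) := fun r => Set.range (node r)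
  have hN : ∀ r, (N r).Infinite := fun r => Set.infinite_range_of_injective (node_inj r)
  have hNco : ∀ r, ((N r)ᶜ).Infinite := fun r => by
    have := node_compl r r
    rwa [Set.union_self] at this
  let Γ : Set ℤ → Submodule F V := fun r => Submodule.span F (b '' N r)
  have hgr : ∀ r, ∃ g : V ≃ₗ[F] V, ∀ v, P v = 0 → g v ∈ Γ r := by
    intro r
    obtain ⟨k⟩ := span_iso hdim b (hN r)
    obtain ⟨g, hg, -⟩ := extend hdim (A := LinearMap.ker P) (D := ⊥) (A' := Γ r) (D' := ⊥)
      disjoint_bot_right disjoint_bot_right (by simpa using hcoW)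
      (by simpa using span_infCo hdim b (hNco r)) (kW ≪≫ₗ k.symm) (LinearEquiv.refl F _)
    refine ⟨g, fun v hv => ?_⟩
    have := hg ⟨v, hv⟩
    simp only at this
    rw [this]
    exact Subtype.property _
  choose γ hγ using hgr
  have hγ' : ∀ r (g : V ≃ₗ[F] V), (∀ a ∈ Γ r, g a = a) → (γ r)⁻¹ * g * γ r ∈ H := by
    intro r g hg
    apply hst
    intro v hv
    change (γ r).symm (g (γ r v)) = v
    rw [hg _ (hγ r v hv), LinearEquiv.symm_apply_apply]
  obtain ⟨r, s, hne, hrs⟩ := hH γ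
  let H' : Subgroup (V ≃ₗ[F] V) := H.comap (MulAut.conj (γ r)⁻¹).toMonoidHom
  have hH' : ∀ g, g ∈ H' ↔ (γ r)⁻¹ * g * γ r ∈ H := by
    intro g
    simp [H', Subgroup.mem_comap]
  have hsplit : N s = (N r ∩ N s) ∪ (N s \ N r) := by
    rw [Set.inter_comm, Set.inter_union_sdiff]
  have hgen := gen hdim S (H := H') (A := Γ r) (B₀ := Submodule.span F (b '' (N s \ N r)))
    (C := Submodule.span F (b '' (N r ∩ N s)))
    (Submodule.span_mono (Set.image_mono Set.inter_subset_left))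
    (b.linearIndependent.disjoint_span_image Set.disjoint_sdiff_right)
    (span_iso hdim b (by
      intro hfin
      apply hN s
      rw [hsplit]
      exact (node_inter hne).union hfin))
    (by
      rw [← Submodule.span_union, ← Set.image_union, Set.union_sdiff_self]
      exact span_infCo hdim b (node_compl r s))
    (fun g hg => (hH' g).mpr (hγ' r g hg))
    (by
      intro g hg
      rw [← Submodule.span_union, ← Set.image_union, ← hsplit] at hg
      have h1 := hγ' s g hg
      rw [hH']
      have h2 := H.mul_mem (H.mul_mem hrs h1) (H.inv_mem hrs)
      convert h2 using 1
      group)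
  refine ⟨(γ r).symm '' (b '' (N r ∩ N s)), ((node_inter hne).image _).image _, fun g hg => ?_⟩
  have h3 : γ r * g * (γ r)⁻¹ ∈ H' := by
    apply hgen
    intro a ha
    induction ha using Submodule.span_induction with
    | mem x hx =>
      change γ r (g ((γ r).symm x)) = x
      rw [hg _ ⟨x, hx, rfl⟩, LinearEquiv.apply_symm_apply]
    | zero => simp
    | add x y _ _ hx hy => rw [map_add, hx, hy]
    | smul c x _ hx => rw [map_smul, hx]
  rw [hH'] at h3
  convert h3 using 1
  group

end SIP

/-- Small index property for countably infinite dimensional vector spaces over a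
finite field (Evans): any subgroup of `GL(V)` of index `< 2^ℵ₀` contains the
pointwise stabilizer of a finite set of vectors. -/
theorem smallIndexProperty_linearAut (F : Type*) [Field F] [Fintype F]
    (V : Type*) [AddCommGroup V] [Module F V]
    (hdim : Module.rank F V = Cardinal.aleph0)
    (H : Subgroup (V ≃ₗ[F] V))
    (hindex : Cardinal.mk ((V ≃ₗ[F] V) ⧸ H) < 2 ^ Cardinal.aleph0) :
    ∃ A : Set V, A.Finite ∧ ∀ g : V ≃ₗ[F] V, (∀ a ∈ A, g a = a) → g ∈ H :=
  SIP.main hdim H (SIP.small_of_index H hindex)
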